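/- Let q be a real number with 2q ∈ ℤ and q not a nonpositive integer, and for each natural number j define c_j = ∑_{i=0}^{2j} (−1)^i · Γ^(i)(q) · Γ^(2j−i)(q) / (i! · (2j−i)!). Then the family (c_j)_{j ∈ ℕ} is linearly independent over the field of real algebraic numbers: for any finitely supported family (λ_j) of real algebraic numbers, if ∑_j λ_j · c_j = 0 then λ_j = 0 for all j. -/

import Mathlib

section PiTranscendental

open Polynomial

/-- The sum of the values of an integer polynomial of degree at most `N` over a Galois-stable
multiset, multiplied by the `N`-th power of a common denominator, is an integer. -/
theorem exists_int_eq_pow_mul_sum_aeval {K : Type*} [Field K] [Algebra ℚ K]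
    [FiniteDimensional ℚ K] [IsGalois ℚ K] (B : Multiset K)
    (hB : ∀ σ : Gal(K/ℚ), B.map σ = B) (a : ℤ) (ha : ∀ b ∈ B, IsIntegral ℤ ((a : K) * b))
    (g : ℤ[X]) (N : ℕ) (hg : g.natDegree ≤ N) :
    ∃ z : ℤ, (a : K) ^ N * (B.map fun b => aeval b g).sum = z := by
  have h_int : IsIntegral ℤ ((a : K) ^ N * (B.map fun b => aeval b g).sum) := by
    rw [← Multiset.sum_map_mul_left]
    refine multiset_sum_mem (S := integralClosure ℤ K) _ fun x hx => ?_
    obtain ⟨b, hb, rfl⟩ := Multiset.mem_map.1 hx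
    rw [aeval_eq_sum_range, Finset.mul_sum]
    refine (integralClosure ℤ K).sum_mem fun i hi => ?_
    have hi' : i ≤ N := (Nat.lt_succ_iff.1 (Finset.mem_range.1 hi)).trans hg
    have : (a : K) ^ N * g.coeff i • b ^ i
        = (a : K) ^ (N - i) * (g.coeff i : K) * ((a : K) * b) ^ i := by
      rw [zsmul_eq_mul, mul_pow]
      nth_rewrite 1 [← Nat.sub_add_cancel hi']
      rw [pow_add]; ring
    rw [this]
    have hZ : ∀ m : ℤ, IsIntegral ℤ (m : K) := fun m => by
      simpa using (isIntegral_algebraMap (R := ℤ) (A := K) (x := m))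
    exact (((hZ a).pow _).mul (hZ _)).mul ((ha b hb).pow i)
  have h_rat : (a : K) ^ N * (B.map fun b => aeval b g).sum ∈ (⊥ : IntermediateField ℚ K) := by
    rw [IsGalois.mem_bot_iff_fixed]
    intro σ
    rw [map_mul, map_pow, map_intCast, map_multiset_sum, Multiset.map_map]
    congr 2
    nth_rewrite 2 [← hB σ]
    rw [Multiset.map_map]
    refine Multiset.map_congr rfl fun b _ => ?_
    simp only [Function.comp_apply]
    exact (aeval_algHom_apply ((σ : K →ₐ[ℚ] K).restrictScalars ℤ) b g).symm
  obtain ⟨r, hr⟩ := IntermediateField.mem_bot.1 h_rat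
  rw [← hr] at h_int ⊢
  obtain ⟨z, hz⟩ := IsIntegrallyClosed.isIntegral_iff.1
    ((isIntegral_algebraMap_iff (algebraMap ℚ K).injective).1 h_int)
  exact ⟨z, by simp [← hz]⟩

theorem exists_int_polynomial_of_zero_notMem {K : Type*} [Field K] [Algebra ℚ K]
    [FiniteDimensional ℚ K] (s : Finset K) (hs : (0 : K) ∉ s) :
    ∃ f : ℤ[X], f.eval 0 ≠ 0 ∧ ∀ b ∈ s, aeval b f = 0 := by
  have h : ∀ b ∈ s, ∃ f : ℤ[X], f.coeff 0 ≠ 0 ∧ aeval b f = 0 := fun b hb =>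
    IsAlgebraic.exists_nonzero_coeff_and_aeval_eq_zero
      ((IsFractionRing.isAlgebraic_iff ℤ ℚ K).2 (Algebra.IsAlgebraic.isAlgebraic b))
      (mem_nonZeroDivisors_of_ne_zero fun h => hs (h ▸ hb))
  choose! f hf0 hf using h
  refine ⟨∏ b ∈ s, f b, ?_, fun b hb => ?_⟩
  · rw [eval_prod, Finset.prod_ne_zero_iff]
    exact fun b hb => by simpa [coeff_zero_eq_eval_zero] using hf0 b hb
  · rw [map_prod]
    exact Finset.prod_eq_zero hb (hf b hb)

theorem eq_zero_of_int_add_sum_exp_eq_zero {K : Type*} [Field K] [Algebra ℚ K]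
    [FiniteDimensional ℚ K] [IsGalois ℚ K] (φ : K →ₐ[ℚ] ℂ) (B : Multiset K) (h0 : 0 ∉ B)
    (hB : ∀ σ : Gal(K/ℚ), B.map σ = B) (k : ℤ)
    (hk : (k : ℂ) + (B.map fun b => Complex.exp (φ b)).sum = 0) : k = 0 := by
  classical
  by_contra hk0
  obtain ⟨f, hf0, hf⟩ := exists_int_polynomial_of_zero_notMem B.toFinset (by simpa using h0)
  obtain ⟨a, ha0, ha⟩ := exists_integral_multiples ℤ ℚ (L := K) B.toFinset
  replace ha : ∀ b ∈ B, IsIntegral ℤ ((a : K) * b) := fun b hb => by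
    simpa using ha b (by simpa using hb)
  obtain ⟨c, hc⟩ := LindemannWeierstrass.exp_polynomial_approx f hf0
  set d := f.natDegree
  have hlim := (FloorSemiring.tendsto_pow_div_factorial_atTop (|(a : ℝ)| ^ d * c)).const_mul
    ((B.card : ℝ) * (|(a : ℝ)| ^ d * c))
  rw [mul_zero] at hlim
  obtain ⟨M, hM⟩ := Filter.eventually_atTop.1 (hlim.eventually (gt_mem_nhds one_pos))
  obtain ⟨p, hp, pp⟩ := Nat.exists_infinite_primes
    (M + 1 + (f.eval 0).natAbs + a.natAbs + k.natAbs + 1)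
  obtain ⟨n, hn, g, hg, happ⟩ := hc p (by omega) pp
  obtain ⟨z, hz⟩ := exists_int_eq_pow_mul_sum_aeval B hB a ha g (p * d) (hg.trans (Nat.sub_le _ _))
  have hz' : (a : ℂ) ^ (p * d) * (B.map fun b => aeval (φ b) g).sum = z := by
    have := congrArg φ hz
    rw [map_mul, map_pow, map_intCast, map_intCast, map_multiset_sum, Multiset.map_map] at this
    rw [← this]
    congr 2
    refine Multiset.map_congr rfl fun b _ => ?_
    exact aeval_algHom_apply (φ.restrictScalars ℤ) b g
  have key : ((a ^ (p * d) * (n * k) + p * z : ℤ) : ℂ) = -((a : ℂ) ^ (p * d) *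
      (B.map fun b => n • Complex.exp (φ b) - p • aeval (φ b) g).sum) := by
    rw [Multiset.sum_map_sub]
    simp only [zsmul_eq_mul, nsmul_eq_mul, Multiset.sum_map_mul_left]
    push_cast
    rw [← hz']
    linear_combination (a : ℂ) ^ (p * d) * n * hk
  have hbound : ‖((a ^ (p * d) * (n * k) + p * z : ℤ) : ℂ)‖ < 1 := by
    have h1 : ‖(B.map fun b => n • Complex.exp (φ b) - p • aeval (φ b) g).sum‖
        ≤ B.card * (c ^ p / ((p - 1).factorial : ℝ)) := by
      refine (norm_multiset_sum_le _).trans ?_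
      rw [Multiset.map_map, ← nsmul_eq_mul]
      refine (Multiset.sum_le_card_nsmul _ (c ^ p / ((p - 1).factorial : ℝ)) ?_).trans (by simp)
      intro x hx
      obtain ⟨b, hb, rfl⟩ := Multiset.mem_map.1 hx
      refine happ ?_
      rw [mem_aroots]
      refine ⟨fun h => hf0 (by simp [h]), ?_⟩
      have := aeval_algHom_apply (φ.restrictScalars ℤ) b f
      rw [hf b (by simpa using hb), map_zero] at this
      exact this
    rw [key, norm_neg, norm_mul, norm_pow]
    have h2 := hM (p - 1) (by omega)
    refine lt_of_le_of_lt (mul_le_mul_of_nonneg_left h1 (by positivity)) (lt_of_eq_of_lt ?_ h2)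
    rw [Complex.norm_intCast]
    obtain ⟨m, rfl⟩ : ∃ m, p = m + 1 := ⟨p - 1, by have := pp.pos; omega⟩
    simp only [Nat.add_sub_cancel]
    ring
  rw [Complex.norm_intCast, ← Int.cast_abs] at hbound
  have hzero : a ^ (p * d) * (n * k) + p * z = 0 := Int.abs_lt_one_iff.1 (by exact_mod_cast hbound)
  have hdvd : (p : ℤ) ∣ a ^ (p * d) * (n * k) :=
    ⟨-z, by linear_combination hzero⟩
  have hpI := Nat.prime_iff_prime_int.1 pp
  have hsmall : ∀ m : ℤ, m ≠ 0 → m.natAbs < p → ¬ (p : ℤ) ∣ m := fun m hm hlt h =>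
    absurd (Nat.le_of_dvd (Int.natAbs_pos.2 hm) (Int.natCast_dvd.1 h)) (by omega)
  rcases hpI.dvd_or_dvd hdvd with h | h
  · exact hsmall a ha0 (by omega) (hpI.dvd_of_dvd_pow h)
  · rcases hpI.dvd_or_dvd h with h | h
    · exact hn h
    · exact hsmall k hk0 (by omega) h

/-- If `exp α = -1`, then `α` is transcendental. -/
theorem transcendental_of_exp_eq_neg_one {α : ℂ} (h : Complex.exp α = -1) :
    Transcendental ℚ α := by
  classical
  intro hα
  set p := minpoly ℚ α
  have hp0 : p ≠ 0 := minpoly.ne_zero hα.isIntegral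
  obtain ⟨K, _, _, _⟩ : ∃ (K : Type) (_ : Field K) (_ : Algebra ℚ K), IsSplittingField ℚ K p :=
    ⟨p.SplittingField, inferInstance, _,
      IsSplittingField.splittingField p⟩
  have : FiniteDimensional ℚ K := IsSplittingField.finiteDimensional K p
  have : Normal ℚ K := Normal.of_isSplittingField p
  have : IsGalois ℚ K := ⟨⟩
  let φ : K →ₐ[ℚ] ℂ := IsSplittingField.lift K p (IsAlgClosed.splits _)
  let R : Finset K := (p.rootSet_finite K).toFinset
  have hRmem : ∀ x, x ∈ R ↔ x ∈ p.rootSet K := fun x => (p.rootSet_finite K).mem_toFinset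
  have hRσ : ∀ σ : Gal(K/ℚ), R.image σ = R := fun σ => by
    have := (IsSplittingField.splits K p).image_rootSet (σ : K →ₐ[ℚ] K)
    ext x
    rw [hRmem, ← this]
    simp only [Finset.mem_image, hRmem, Set.mem_image]
    rfl
  obtain ⟨θ, hθ, hθα⟩ : ∃ θ ∈ R, φ θ = α := by
    have h1 : α ∈ p.rootSet ℂ := (mem_rootSet).2 ⟨hp0, minpoly.aeval ℚ α⟩
    rw [← (IsSplittingField.splits K p).image_rootSet φ] at h1
    obtain ⟨θ, hθ, e⟩ := h1
    exact ⟨θ, (hRmem θ).2 hθ, e⟩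
  have hprod : ∏ x ∈ R, (1 + Complex.exp (φ x)) = 0 :=
    Finset.prod_eq_zero hθ (by rw [hθα, h]; ring)
  rw [Finset.prod_one_add] at hprod
  set T := R.powerset.filter fun t => ∑ x ∈ t, x ≠ 0
  set Z := R.powerset.filter fun t => ¬ ∑ x ∈ t, x ≠ 0
  have hsum : ((Z.card : ℤ) : ℂ) +
      ((T.val.map fun t => ∑ x ∈ t, x).map fun b => Complex.exp (φ b)).sum = 0 := by
    rw [Multiset.map_map, ← hprod,
      ← Finset.sum_filter_add_sum_filter_not R.powerset (fun t => ∑ x ∈ t, x ≠ 0), add_comm]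
    congr 1
    · change ∑ t ∈ T, Complex.exp (φ (∑ x ∈ t, x)) = _
      exact Finset.sum_congr rfl fun t _ => by rw [map_sum, Complex.exp_sum]
    · rw [Finset.sum_congr rfl fun t ht => ?_, Finset.sum_const, nsmul_eq_mul, mul_one]
      · rfl
      · rw [← Complex.exp_sum, ← map_sum, not_not.1 (Finset.mem_filter.1 ht).2, map_zero,
          Complex.exp_zero]
  have hT : ∀ σ : Gal(K/ℚ), (T.val.map fun t => ∑ x ∈ t, x).map σ
      = T.val.map fun t => ∑ x ∈ t, x := fun σ => by
    have hTσ : T.image (fun t => t.image σ) = T := by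
      refine Finset.eq_of_subset_of_card_le ?_ ?_
      · intro u hu
        obtain ⟨t, ht, rfl⟩ := Finset.mem_image.1 hu
        obtain ⟨ht1, ht2⟩ := Finset.mem_filter.1 ht
        refine Finset.mem_filter.2 ⟨?_, ?_⟩
        · rw [Finset.mem_powerset, ← hRσ σ]
          exact Finset.image_subset_image (Finset.mem_powerset.1 ht1)
        · rw [Finset.sum_image σ.injective.injOn, ← map_sum]
          exact fun h => ht2 ((map_eq_zero σ).1 h)
      · rw [Finset.card_image_of_injective _ (Finset.image_injective σ.injective)]
    rw [Multiset.map_map]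
    conv_rhs => rw [← hTσ]
    rw [Finset.image_val_of_injOn (Finset.image_injective σ.injective).injOn, Multiset.map_map]
    refine Multiset.map_congr rfl fun t _ => ?_
    simp only [Function.comp_apply]
    rw [Finset.sum_image σ.injective.injOn, map_sum]
  have h0 : (0 : K) ∉ T.val.map fun t => ∑ x ∈ t, x := fun h0 => by
    obtain ⟨t, ht, e⟩ := Multiset.mem_map.1 h0
    exact (Finset.mem_filter.1 ht).2 e
  have hcard := eq_zero_of_int_add_sum_exp_eq_zero φ _ h0 hT _ hsum
  have hZ : (∅ : Finset K) ∈ Z := by simp [Z]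
  exact absurd (Finset.card_pos.2 ⟨_, hZ⟩) (by omega)

theorem Real.transcendental_pi : Transcendental ℚ Real.pi := by
  intro h
  have hI : IsAlgebraic ℚ Complex.I := by
    refine ⟨X ^ 2 + 1, fun h => ?_, by simp⟩
    simpa using congrArg (Polynomial.eval 0) h
  exact transcendental_of_exp_eq_neg_one Complex.exp_pi_mul_I
    (((isAlgebraic_algebraMap_iff (S := ℝ) (A := ℂ) Complex.ofReal_injective).2 h).mul hI)

end PiTranscendental

section SecantSeries

open PowerSeries

theorem PowerSeries.coeff_mul_nonneg {f g : ℚ⟦X⟧} {n : ℕ} (hf : ∀ i ≤ n, 0 ≤ coeff i f)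
    (hg : ∀ i ≤ n, 0 ≤ coeff i g) : 0 ≤ coeff n (f * g) := by
  rw [coeff_mul]
  exact Finset.sum_nonneg fun i hi => mul_nonneg
    (hf _ (Finset.HasAntidiagonal.antidiagonal.fst_le hi)) (hg _ (Finset.HasAntidiagonal.antidiagonal.snd_le hi))

/-- A power series solution of a Riccati equation has nonnegative coefficients. -/
theorem PowerSeries.coeff_nonneg_of_riccati {G : ℚ⟦X⟧} {κ : ℕ → ℚ} (hκ : ∀ n, 0 < κ n)
    (h0 : coeff 0 G = 0) (h : ∀ n, κ n * coeff (n + 1) G = coeff n (1 + G * G)) (n : ℕ) :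
    0 ≤ coeff n G := by
  induction n using Nat.strong_induction_on with
  | _ n ih =>
    rcases n with _ | n
    · exact h0.ge
    · refine nonneg_of_mul_nonneg_right (a := κ n) ?_ (hκ n)
      have ih' : ∀ i ≤ n, 0 ≤ coeff i G := fun i hi => ih i (Nat.lt_succ_iff.2 hi)
      rw [h, map_add, coeff_one]
      exact add_nonneg (by split_ifs <;> simp) (coeff_mul_nonneg ih' ih')

theorem PowerSeries.coeff_one_pos_of_riccati {G : ℚ⟦X⟧} {κ : ℕ → ℚ} (hκ : ∀ n, 0 < κ n)
    (h0 : coeff 0 G = 0) (h : ∀ n, κ n * coeff (n + 1) G = coeff n (1 + G * G)) :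
    0 < coeff 1 G := by
  refine pos_of_mul_pos_right (a := κ 0) ?_ (hκ 0).le
  have := h 0
  rw [map_add, coeff_mul] at this
  simp [h0] at this
  simp [this]

/-- If the logarithmic derivative of `F` has nonnegative coefficients and positive linear
coefficient, then the even coefficients of `F` are positive. -/
theorem PowerSeries.coeff_even_pos_of_derivative_eq_mul {F G : ℚ⟦X⟧} (hG : ∀ n, 0 ≤ coeff n G)
    (hG1 : 0 < coeff 1 G) (hF0 : 0 < coeff 0 F) (hF : derivative ℚ F = F * G) (j : ℕ) :
    0 < coeff (2 * j) F := by
  have hrec : ∀ n, coeff (n + 1) F * (n + 1) = coeff n (F * G) := fun n => by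
    rw [← hF, coeff_derivative]
  have hnn : ∀ n, 0 ≤ coeff n F := fun n => by
    induction n using Nat.strong_induction_on with
    | _ n ih =>
      rcases n with _ | n
      · exact hF0.le
      · refine nonneg_of_mul_nonneg_left (b := (n + 1 : ℚ)) ?_ (by positivity)
        rw [hrec]
        exact coeff_mul_nonneg (fun i hi => ih i (Nat.lt_succ_iff.2 hi)) fun i _ => hG i
  induction j with
  | zero => exact hF0
  | succ j ih =>
    refine pos_of_mul_pos_left (b := ((2 * j + 1 : ℕ) + 1 : ℚ)) ?_ (by positivity)
    rw [show 2 * (j + 1) = 2 * j + 1 + 1 by ring, hrec, coeff_mul]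
    refine Finset.sum_pos' (fun i _ => mul_nonneg (hnn _) (hG _)) ⟨(2 * j, 1), ?_, ?_⟩
    · simp
    · exact mul_pos ih hG1

theorem PowerSeries.derivative_sin : derivative ℚ (sin ℚ) = cos ℚ := by
  ext n
  rw [coeff_derivative]
  simp only [sin, cos, coeff_mk]
  rcases Nat.even_or_odd n with h | h
  · obtain ⟨k, rfl⟩ := h.two_dvd
    have h1 : (2 * k + 1) / 2 = k := by omega
    have h2 : ¬ Even (2 * k + 1) := by simp
    rw [if_neg h2, if_pos h, h1, Nat.factorial_succ]
    simp
    field_simp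
  · simp [h.add_one, Nat.not_even_iff_odd.2 h]

theorem PowerSeries.derivative_cos : derivative ℚ (cos ℚ) = -sin ℚ := by
  ext n
  rw [coeff_derivative]
  simp only [sin, cos, coeff_mk, map_neg]
  rcases Nat.even_or_odd n with h | h
  · have h2 : ¬ Even (n + 1) := Nat.not_even_iff_odd.2 h.add_one
    rw [if_neg h2, if_pos h]
    simp
  · obtain ⟨k, rfl⟩ := h
    have h1 : (2 * k + 1 + 1) / 2 = k + 1 := by omega
    have h3 : (2 * k + 1) / 2 = k := by omega
    have h2 : ¬ Even (2 * k + 1) := by simp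
    rw [if_neg h2, if_pos (by simp [parity_simps]), h1, h3, Nat.factorial_succ (2 * k + 1)]
    simp
    field_simp
    ring

theorem PowerSeries.constantCoeff_cos : constantCoeff (cos ℚ) = 1 := by
  simp [cos, ← coeff_zero_eq_constantCoeff_apply]

theorem PowerSeries.coeff_even_inv_cos_pos (j : ℕ) : 0 < coeff (2 * j) (cos ℚ)⁻¹ := by
  have hc : cos ℚ * (cos ℚ)⁻¹ = 1 := PowerSeries.mul_inv_cancel _ (by simp [constantCoeff_cos])
  have hd : derivative ℚ (cos ℚ)⁻¹ = (cos ℚ)⁻¹ * (sin ℚ * (cos ℚ)⁻¹) := by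
    rw [derivative_inv', derivative_cos]; ring
  have hG : derivative ℚ (sin ℚ * (cos ℚ)⁻¹)
      = 1 + (sin ℚ * (cos ℚ)⁻¹) * (sin ℚ * (cos ℚ)⁻¹) := by
    rw [Derivation.leibniz, hd, derivative_sin, smul_eq_mul, smul_eq_mul]
    linear_combination hc
  have h0 : coeff 0 (sin ℚ * (cos ℚ)⁻¹) = 0 := by
    simp [sin, coeff_mul]
  have hκ : ∀ n : ℕ, (0 : ℚ) < n + 1 := fun n => by positivity
  have h : ∀ n : ℕ, (n + 1 : ℚ) * coeff (n + 1) (sin ℚ * (cos ℚ)⁻¹)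
      = coeff n (1 + (sin ℚ * (cos ℚ)⁻¹) * (sin ℚ * (cos ℚ)⁻¹)) := fun n => by
    rw [← hG, coeff_derivative, mul_comm]
  exact coeff_even_pos_of_derivative_eq_mul (coeff_nonneg_of_riccati hκ h0 h)
    (coeff_one_pos_of_riccati hκ h0 h) (by simp [constantCoeff_cos]) hd j

/-- The power series of `sin x / x`. -/
noncomputable def PowerSeries.sincSeries : ℚ⟦X⟧ := mk fun n => coeff (n + 1) (sin ℚ)

theorem PowerSeries.X_mul_sincSeries : X * sincSeries = sin ℚ := by
  ext n
  rcases n with _ | n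
  · simp [sin]
  · simp [coeff_succ_X_mul, sincSeries]

theorem PowerSeries.constantCoeff_sincSeries : constantCoeff sincSeries = 1 := by
  simp [sincSeries, sin, ← coeff_zero_eq_constantCoeff_apply]

theorem PowerSeries.coeff_even_inv_sincSeries_pos (j : ℕ) :
    0 < coeff (2 * j) sincSeries⁻¹ := by
  set W := sincSeries with hW
  have hc : W * W⁻¹ = 1 := PowerSeries.mul_inv_cancel _ (by simp [hW, constantCoeff_sincSeries])
  have hd : derivative ℚ W⁻¹ = W⁻¹ * (-derivative ℚ W * W⁻¹) := by
    rw [derivative_inv']; ring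
  have h1 : X * derivative ℚ W + W = cos ℚ := by
    rw [← derivative_sin, ← X_mul_sincSeries, Derivation.leibniz, derivative_X, smul_eq_mul,
      smul_eq_mul, mul_one]
  have h2 : X * derivative ℚ (derivative ℚ W) + 2 * derivative ℚ W = -(X * W) := by
    have := congrArg (derivative ℚ) h1
    rw [derivative_cos, ← X_mul_sincSeries, map_add, Derivation.leibniz, derivative_X, smul_eq_mul,
      smul_eq_mul, mul_one] at this
    linear_combination this
  set G := -derivative ℚ W * W⁻¹ with hG_def
  have hG : X * derivative ℚ G + 2 * G = X * (1 + G * G) := by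
    have h3 : derivative ℚ G = -derivative ℚ W * (W⁻¹ * G)
        + W⁻¹ * -derivative ℚ (derivative ℚ W) := by
      rw [hG_def, Derivation.leibniz, hd, map_neg, smul_eq_mul, smul_eq_mul]
    rw [h3]
    linear_combination (-W⁻¹) * h2 + X * hc + (-X * G - 2) * hG_def
  have h_two : (2 : ℚ⟦X⟧) = C 2 := (map_ofNat C 2).symm
  have h0 : coeff 0 G = 0 := by
    have := congrArg (coeff 0) hG
    rw [h_two] at this
    simpa using this
  have hκ : ∀ n : ℕ, (0 : ℚ) < n + 3 := fun n => by positivity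
  have h : ∀ n : ℕ, (n + 3 : ℚ) * coeff (n + 1) G = coeff n (1 + G * G) := fun n => by
    have := congrArg (coeff (n + 1)) hG
    rw [map_add, coeff_succ_X_mul, coeff_succ_X_mul, coeff_derivative,
      h_two, coeff_C_mul] at this
    linear_combination this
  exact coeff_even_pos_of_derivative_eq_mul (coeff_nonneg_of_riccati hκ h0 h)
    (coeff_one_pos_of_riccati hκ h0 h) (by simp [hW, constantCoeff_sincSeries]) hd j

end SecantSeries

section TaylorSeries

open PowerSeries
open scoped ContDiff

/-- The formal Taylor series of a real function at a point. -/
noncomputable def taylorSeriesAt (f : ℝ → ℝ) (x : ℝ) : ℝ⟦X⟧ :=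
  mk fun n => iteratedDeriv n f x / (n.factorial : ℝ)

theorem taylorSeriesAt_congr {f g : ℝ → ℝ} {x : ℝ} (h : f =ᶠ[nhds x] g) :
    taylorSeriesAt f x = taylorSeriesAt g x := by
  ext n
  simp only [taylorSeriesAt, coeff_mk, h.iteratedDeriv_eq n]

theorem taylorSeriesAt_mul {f g : ℝ → ℝ} {x : ℝ} (hf : ContDiffAt ℝ ∞ f x)
    (hg : ContDiffAt ℝ ∞ g x) :
    taylorSeriesAt (fun y => f y * g y) x = taylorSeriesAt f x * taylorSeriesAt g x := by
  ext n
  have hn : (n : WithTop ℕ∞) ≤ ∞ := by exact_mod_cast le_top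
  rw [coeff_mul, Finset.Nat.sum_antidiagonal_eq_sum_range_succ_mk]
  simp only [taylorSeriesAt, coeff_mk]
  rw [iteratedDeriv_fun_mul (hf.of_le hn) (hg.of_le hn), Finset.sum_div]
  refine Finset.sum_congr rfl fun i hi => ?_
  rw [Nat.cast_choose ℝ (Nat.lt_succ_iff.1 (Finset.mem_range.1 hi))]
  field_simp

theorem taylorSeriesAt_comp_const_add (f : ℝ → ℝ) (q : ℝ) :
    taylorSeriesAt (fun t => f (q + t)) 0 = taylorSeriesAt f q := by
  ext n
  simp only [taylorSeriesAt, coeff_mk, iteratedDeriv_comp_const_add, add_zero]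

theorem taylorSeriesAt_comp_add_const (f : ℝ → ℝ) (q s : ℝ) :
    taylorSeriesAt (fun t => f (t + s)) q = taylorSeriesAt f (q + s) := by
  ext n
  simp only [taylorSeriesAt, coeff_mk, iteratedDeriv_comp_add_const]

theorem taylorSeriesAt_comp_const_sub (f : ℝ → ℝ) (q : ℝ) :
    taylorSeriesAt (fun t => f (q - t)) 0 = rescale (-1) (taylorSeriesAt f q) := by
  ext n
  simp only [taylorSeriesAt, coeff_rescale, coeff_mk, iteratedDeriv_comp_const_sub, sub_zero,
    smul_eq_mul, mul_div_assoc]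

theorem taylorSeriesAt_comp_const_mul {f : ℝ → ℝ} (hf : ContDiff ℝ ∞ f) (c : ℝ) :
    taylorSeriesAt (fun t => f (c * t)) 0 = rescale c (taylorSeriesAt f 0) := by
  ext n
  simp only [taylorSeriesAt, coeff_rescale, coeff_mk,
    iteratedDeriv_comp_const_mul (hf.of_le (by exact_mod_cast le_top)), mul_zero, mul_div_assoc]

theorem taylorSeriesAt_id (x : ℝ) : taylorSeriesAt (fun y => y) x = C x + X := by
  ext n
  simp only [taylorSeriesAt, coeff_mk, iteratedDeriv_fun_id, map_add, coeff_C, coeff_X]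
  rcases n with _ | _ | n <;> simp

theorem taylorSeriesAt_const (c x : ℝ) : taylorSeriesAt (fun _ => c) x = C c := by
  ext n
  simp only [taylorSeriesAt, coeff_mk, iteratedDeriv_const, coeff_C]
  split_ifs with h <;> simp [h]

theorem taylorSeriesAt_sin_zero : taylorSeriesAt Real.sin 0 = map (algebraMap ℚ ℝ) (sin ℚ) := by
  ext n
  simp only [taylorSeriesAt, coeff_mk, sin]
  obtain ⟨k, rfl | rfl⟩ := n.even_or_odd'
  · simp
  · have h : (2 * k + 1) / 2 = k := by omega
    simp [h]

theorem taylorSeriesAt_cos_zero : taylorSeriesAt Real.cos 0 = map (algebraMap ℚ ℝ) (cos ℚ) := by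
  ext n
  simp only [taylorSeriesAt, coeff_mk, cos]
  obtain ⟨k, rfl | rfl⟩ := n.even_or_odd'
  · simp
  · simp

theorem Real.contDiffAt_Gamma {q : ℝ} (hq : ∀ m : ℕ, q ≠ -m) : ContDiffAt ℝ ∞ Real.Gamma q := by
  have h : ContDiffAt ℂ ∞ Complex.Gamma (q : ℂ) := by
    have h1 := Complex.differentiable_one_div_Gamma.contDiff (n := ∞)
    have h2 : ContDiffAt ℂ ∞ (fun s => ((Complex.Gamma s)⁻¹)⁻¹) (q : ℂ) :=
      (h1.contDiffAt (x := (q : ℂ))).inv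
        (inv_ne_zero (Complex.Gamma_ne_zero fun m h => hq m (by exact_mod_cast h)))
    simpa only [inv_inv] using h2
  exact h.real_of_complex

/-- The formal Taylor series of `t ↦ Γ(q - t) * Γ(q + t)` at `0`. -/
noncomputable def gammaReflectionSeries (q : ℝ) : ℝ⟦X⟧ :=
  rescale (-1) (taylorSeriesAt Real.Gamma q) * taylorSeriesAt Real.Gamma q

theorem coeff_gammaReflectionSeries (q : ℝ) (n : ℕ) :
    coeff n (gammaReflectionSeries q) = ∑ i ∈ Finset.range (n + 1),
      (-1 : ℝ) ^ i * iteratedDeriv i Real.Gamma q * iteratedDeriv (n - i) Real.Gamma q /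
        ((Nat.factorial i : ℝ) * (Nat.factorial (n - i) : ℝ)) := by
  rw [gammaReflectionSeries, coeff_mul, Finset.Nat.sum_antidiagonal_eq_sum_range_succ_mk]
  refine Finset.sum_congr rfl fun i _ => ?_
  simp only [taylorSeriesAt, coeff_rescale, coeff_mk]
  field_simp

theorem taylorSeriesAt_Gamma_reflection {q : ℝ} (hq : ∀ m : ℕ, q ≠ -m) :
    taylorSeriesAt (fun t => Real.Gamma (q - t) * Real.Gamma (q + t)) 0
      = gammaReflectionSeries q := by
  have hG := Real.contDiffAt_Gamma hq
  rw [taylorSeriesAt_mul, taylorSeriesAt_comp_const_add, taylorSeriesAt_comp_const_sub,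
    gammaReflectionSeries]
  · exact ContDiffAt.comp (0 : ℝ) (g := Real.Gamma) (f := fun t => q - t) (by simpa using hG)
      (by fun_prop)
  · exact ContDiffAt.comp (0 : ℝ) (g := Real.Gamma) (f := fun t => q + t) (by simpa using hG)
      (by fun_prop)

theorem contDiffAt_Gamma_reflection {q : ℝ} (hq : ∀ m : ℕ, q ≠ -m) :
    ContDiffAt ℝ ∞ (fun t => Real.Gamma (q - t) * Real.Gamma (q + t)) 0 := by
  have hG := Real.contDiffAt_Gamma hq
  exact (ContDiffAt.comp (0 : ℝ) (g := Real.Gamma) (f := fun t => q - t) (by simpa using hG)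
      (by fun_prop)).mul
    (ContDiffAt.comp (0 : ℝ) (g := Real.Gamma) (f := fun t => q + t) (by simpa using hG)
      (by fun_prop))

theorem gammaReflectionSeries_add_one {q : ℝ} (hq : ∀ m : ℕ, q ≠ -m) :
    gammaReflectionSeries (q + 1) = (C (q ^ 2) - X ^ 2) * gammaReflectionSeries q := by
  have hq0 : q ≠ 0 := by simpa using hq 0
  have h : taylorSeriesAt Real.Gamma (q + 1) = (C q + X) * taylorSeriesAt Real.Gamma q := by
    rw [← taylorSeriesAt_comp_add_const, ← taylorSeriesAt_id,
      ← taylorSeriesAt_mul contDiffAt_fun_id (Real.contDiffAt_Gamma hq)]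
    refine taylorSeriesAt_congr ?_
    filter_upwards [eventually_ne_nhds hq0] with y hy using Real.Gamma_add_one hy
  rw [gammaReflectionSeries, h, map_mul, map_add, rescale_neg_one_X, gammaReflectionSeries]
  have hC : rescale (-1) (C q) = C q := by
    ext n
    rw [coeff_rescale, coeff_C]
    split_ifs with h <;> simp [h]
  rw [hC, map_pow]
  ring

theorem gammaReflectionSeries_half_mul_cos :
    gammaReflectionSeries (1 / 2) * rescale Real.pi (map (algebraMap ℚ ℝ) (cos ℚ))
      = C Real.pi := by
  have hq : ∀ m : ℕ, (1 / 2 : ℝ) ≠ -m := fun m h => by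
    have : (0 : ℝ) ≤ m := m.cast_nonneg
    linarith
  rw [← taylorSeriesAt_Gamma_reflection hq, ← taylorSeriesAt_cos_zero,
    ← taylorSeriesAt_comp_const_mul Real.contDiff_cos,
    ← taylorSeriesAt_mul (contDiffAt_Gamma_reflection hq) (by fun_prop),
    ← taylorSeriesAt_const Real.pi 0]
  refine taylorSeriesAt_congr ?_
  have hcos : ∀ᶠ t : ℝ in nhds 0, Real.cos (Real.pi * t) ≠ 0 :=
    ContinuousAt.eventually_ne (by fun_prop) (by simp)
  filter_upwards [hcos] with t ht
  have := Real.Gamma_mul_Gamma_one_sub (1 / 2 - t)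
  rw [show Real.pi * (1 / 2 - t) = Real.pi / 2 - Real.pi * t by ring, Real.sin_pi_div_two_sub,
    show 1 - (1 / 2 - t) = 1 / 2 + t by ring] at this
  rw [this, div_mul_cancel₀ _ ht]

theorem gammaReflectionSeries_one_mul_sin :
    gammaReflectionSeries 1 * rescale Real.pi (map (algebraMap ℚ ℝ) (sin ℚ))
      = C Real.pi * X := by
  have hq : ∀ m : ℕ, (1 : ℝ) ≠ -m := fun m h => by
    have : (0 : ℝ) ≤ m := m.cast_nonneg
    linarith
  have hX : (X : ℝ⟦X⟧) = taylorSeriesAt (fun y => y) 0 := by rw [taylorSeriesAt_id]; simp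
  rw [← taylorSeriesAt_Gamma_reflection hq, ← taylorSeriesAt_sin_zero,
    ← taylorSeriesAt_comp_const_mul Real.contDiff_sin,
    ← taylorSeriesAt_mul (contDiffAt_Gamma_reflection hq) (by fun_prop),
    ← taylorSeriesAt_const Real.pi 0, hX, ← taylorSeriesAt_mul contDiffAt_const contDiffAt_fun_id]
  refine taylorSeriesAt_congr ?_
  have hball := Metric.ball_mem_nhds (0 : ℝ) one_pos
  filter_upwards [hball] with t ht
  rcases eq_or_ne t 0 with rfl | h0
  · simp
  have ht' : |t| < 1 := by simpa using ht
  have hsin : Real.sin (Real.pi * t) ≠ 0 := fun h => by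
    obtain ⟨n, hn⟩ := Real.sin_eq_zero_iff.1 h
    have hnt : (n : ℝ) = t := mul_left_cancel₀ Real.pi_ne_zero (by linarith)
    rw [← hnt, ← Int.cast_abs] at ht'
    have : n = 0 := Int.abs_lt_one_iff.1 (by exact_mod_cast ht')
    exact h0 (by rw [← hnt, this, Int.cast_zero])
  have := Real.Gamma_mul_Gamma_one_sub t
  rw [add_comm 1 t, Real.Gamma_add_one h0, mul_left_comm, mul_comm (Real.Gamma (1 - t)), this,
    mul_assoc, div_mul_cancel₀ _ hsin, mul_comm]

end TaylorSeries

section LinearIndependence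

open Polynomial

/-- Polynomials over `ℚ` of strictly increasing degrees, evaluated at a transcendental real number,
are linearly independent over the real algebraic numbers. -/
theorem eq_zero_of_finsum_mul_aeval_transcendental_eq_zero {x : ℝ} (hx : Transcendental ℚ x)
    {p : ℕ → ℚ[X]} (hp0 : ∀ j, p j ≠ 0) (hp : StrictMono fun j => (p j).natDegree)
    {lam : ℕ → ℝ} (halg : ∀ j, IsAlgebraic ℚ (lam j)) (hfin : (Function.support lam).Finite)
    (hsum : ∑ᶠ j : ℕ, lam j * aeval x (p j) = 0) (j : ℕ) : lam j = 0 := by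
  by_contra hj
  have hne : hfin.toFinset.Nonempty := ⟨j, by simpa using hj⟩
  set m := hfin.toFinset.max' hne
  have hm : m ∈ hfin.toFinset := Finset.max'_mem _ _
  have hm0 : lam m ≠ 0 := by simpa using hm
  let A := algebraicClosure ℚ ℝ
  let l : ℕ → A := fun i => ⟨lam i, mem_algebraicClosure_iff.2 (halg i)⟩
  let Q : A[X] := ∑ i ∈ hfin.toFinset, C (l i) * (p i).map (algebraMap ℚ A)
  have hQ : aeval x Q = 0 := by
    rw [finsum_eq_sum_of_support_subset (s := hfin.toFinset) _ fun i hi => by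
      simpa using left_ne_zero_of_mul hi] at hsum
    rw [← hsum]
    simp only [Q, map_sum, map_mul, aeval_C, aeval_map_algebraMap]
    rfl
  have hQ0 : Q ≠ 0 := fun h => by
    have h1 : Q.coeff (p m).natDegree = l m * algebraMap ℚ A (p m).leadingCoeff := by
      simp only [Q, finsetSum_coeff, coeff_C_mul, coeff_map]
      refine Finset.sum_eq_single_of_mem m hm fun i hi hne' => ?_
      have hlt : i < m := lt_of_le_of_ne (Finset.le_max' _ _ hi) hne'
      rw [coeff_eq_zero_of_natDegree_lt (hp hlt), map_zero, mul_zero]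
    rw [h, coeff_zero] at h1
    refine mul_ne_zero (fun h2 => hm0 ?_) ?_ h1.symm
    · exact congrArg Subtype.val h2
    · exact (_root_.map_ne_zero _).2 (leadingCoeff_ne_zero.2 (hp0 m))
  have : Algebra.IsAlgebraic ℚ A := algebraicClosure.isAlgebraic ℚ ℝ
  exact hx (IsAlgebraic.restrictScalars ℚ (S := A) ⟨Q, hQ0, hQ⟩)

end LinearIndependence

section GammaReflection

open PowerSeries

/-- The reflection series at `q`, up to a rational power series, is `π ^ e * S (π * t)`. -/
def GammaReflectionForm (e : ℕ) (S : ℚ⟦X⟧) (q : ℚ) : Prop :=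
  ∃ P : ℚ⟦X⟧, constantCoeff P ≠ 0 ∧ gammaReflectionSeries q =
    C (Real.pi ^ e) * map (algebraMap ℚ ℝ) P * rescale Real.pi (map (algebraMap ℚ ℝ) S)

theorem gammaReflectionSeries_add_one_eq_map_mul {q : ℚ} (hq : ∀ m : ℕ, q ≠ -m) :
    gammaReflectionSeries ((q + 1 : ℚ) : ℝ)
      = map (algebraMap ℚ ℝ) (C (q ^ 2) - X ^ 2) * gammaReflectionSeries q := by
  rw [Rat.cast_add, Rat.cast_one,
    gammaReflectionSeries_add_one fun m h => hq m (by exact_mod_cast h)]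
  simp

theorem GammaReflectionForm.add_one {e : ℕ} {S : ℚ⟦X⟧} {q : ℚ} (hq : ∀ m : ℕ, q ≠ -m)
    (h : GammaReflectionForm e S q) : GammaReflectionForm e S (q + 1) := by
  obtain ⟨P, hP, h⟩ := h
  have hq0 : q ≠ 0 := by simpa using hq 0
  refine ⟨(C (q ^ 2) - X ^ 2) * P, by simp [hq0, hP], ?_⟩
  rw [gammaReflectionSeries_add_one_eq_map_mul hq, h, map_mul]
  ring

theorem GammaReflectionForm.of_add_one {e : ℕ} {S : ℚ⟦X⟧} {q : ℚ} (hq : ∀ m : ℕ, q ≠ -m)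
    (h : GammaReflectionForm e S (q + 1)) : GammaReflectionForm e S q := by
  obtain ⟨P, hP, h⟩ := h
  have hq0 : q ≠ 0 := by simpa using hq 0
  have hR : constantCoeff (C (q ^ 2) - X ^ 2 : ℚ⟦X⟧) ≠ 0 := by simp [hq0]
  refine ⟨(C (q ^ 2) - X ^ 2)⁻¹ * P, by simp [hq0, hP], ?_⟩
  rw [gammaReflectionSeries_add_one_eq_map_mul hq] at h
  have h1 := congrArg (map (algebraMap ℚ ℝ)) (PowerSeries.mul_inv_cancel _ hR)
  rw [map_mul, map_one] at h1
  rw [map_mul]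
  linear_combination (map (algebraMap ℚ ℝ) (C (q ^ 2) - X ^ 2)⁻¹) * h
    - gammaReflectionSeries q * h1

theorem GammaReflectionForm.half : GammaReflectionForm 1 (cos ℚ)⁻¹ (1 / 2) := by
  refine ⟨1, by simp, ?_⟩
  have hc : cos ℚ * (cos ℚ)⁻¹ = 1 := PowerSeries.mul_inv_cancel _ (by simp [constantCoeff_cos])
  have h := congrArg (fun f => rescale Real.pi (map (algebraMap ℚ ℝ) f)) hc
  simp only [map_mul, map_one] at h
  have h1 := gammaReflectionSeries_half_mul_cos
  push_cast
  rw [map_one, pow_one, mul_one]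
  linear_combination (rescale Real.pi (map (algebraMap ℚ ℝ) (cos ℚ)⁻¹)) * h1
    - gammaReflectionSeries (1 / 2) * h

theorem GammaReflectionForm.one : GammaReflectionForm 0 sincSeries⁻¹ 1 := by
  refine ⟨1, by simp, ?_⟩
  have hc : sincSeries * sincSeries⁻¹ = 1 :=
    PowerSeries.mul_inv_cancel _ (by simp [constantCoeff_sincSeries])
  have h := congrArg (fun f => rescale Real.pi (map (algebraMap ℚ ℝ) f)) hc
  simp only [map_mul, map_one] at h
  have h1 := gammaReflectionSeries_one_mul_sin
  rw [← X_mul_sincSeries, map_mul, map_mul, map_X, rescale_X] at h1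
  have h2 : gammaReflectionSeries 1 * rescale Real.pi (map (algebraMap ℚ ℝ) sincSeries) = 1 := by
    have hne : (C Real.pi * X : ℝ⟦X⟧) ≠ 0 :=
      mul_ne_zero ((map_ne_zero_iff _ C_injective).2 Real.pi_ne_zero) X_ne_zero
    refine mul_left_cancel₀ hne ?_
    linear_combination h1
  rw [map_one, pow_zero, map_one, mul_one, one_mul, Rat.cast_one]
  linear_combination (rescale Real.pi (map (algebraMap ℚ ℝ) sincSeries⁻¹)) * h2
    - gammaReflectionSeries 1 * h

theorem GammaReflectionForm.natCast_add_one (n : ℕ) :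
    GammaReflectionForm 0 sincSeries⁻¹ (n + 1) := by
  induction n with
  | zero => simpa using GammaReflectionForm.one
  | succ n ih =>
    push_cast
    refine ih.add_one fun m h => ?_
    have : (0 : ℚ) < n + 1 + m := by positivity
    linarith

theorem GammaReflectionForm.int_add_half (k : ℤ) :
    GammaReflectionForm 1 (cos ℚ)⁻¹ (k + 1 / 2) := by
  have hk : ∀ (k : ℤ) (m : ℕ), (k + 1 / 2 : ℚ) ≠ -m := fun k m h => by
    have : 2 * k + 1 = -(2 * m : ℤ) := by
      have h' : (2 * k + 1 : ℚ) = -(2 * m) := by linarith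
      exact_mod_cast h'
    omega
  induction k with
  | zero => simpa using GammaReflectionForm.half
  | succ i ih =>
    have := ih.add_one (hk _)
    push_cast at this ⊢
    rwa [add_right_comm] at this
  | pred i ih =>
    refine GammaReflectionForm.of_add_one (hk _) ?_
    push_cast at ih ⊢
    rwa [add_right_comm, sub_add_cancel]

/-- Every admissible reflection series has the form `π ^ e * P t * S (π * t)` with `P` rational and
`S` rational with positive even coefficients. -/
theorem exists_gammaReflectionForm {q : ℝ} (hq : ∃ k : ℤ, 2 * q = (k : ℝ))
    (hq' : ¬ ∃ k : ℤ, k ≤ 0 ∧ q = (k : ℝ)) :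
    ∃ (e : ℕ) (S : ℚ⟦X⟧) (r : ℚ), q = r ∧ (∀ j, 0 < coeff (2 * j) S) ∧
      GammaReflectionForm e S r := by
  obtain ⟨k, hk⟩ := hq
  obtain ⟨m, rfl | rfl⟩ := k.even_or_odd'
  · have hqm : q = m := by push_cast at hk; linarith
    have hm : 0 < m := not_le.1 fun h => hq' ⟨m, h, hqm⟩
    obtain ⟨n, rfl⟩ : ∃ n : ℕ, m = n + 1 := ⟨(m - 1).toNat, by omega⟩
    exact ⟨0, _, n + 1, by rw [hqm]; push_cast; rfl, coeff_even_inv_sincSeries_pos,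
      GammaReflectionForm.natCast_add_one n⟩
  · have hqm : q = m + 1 / 2 := by push_cast at hk; linarith
    exact ⟨1, _, m + 1 / 2, by rw [hqm]; push_cast; rfl, coeff_even_inv_cos_pos,
      GammaReflectionForm.int_add_half m⟩

theorem GammaReflectionForm.exists_coeff_eq_aeval {e : ℕ} {S : ℚ⟦X⟧} {q : ℚ}
    (h : GammaReflectionForm e S q) {n : ℕ} (hS : coeff n S ≠ 0) :
    ∃ p : Polynomial ℚ, p ≠ 0 ∧ p.natDegree = n + e ∧
      coeff n (gammaReflectionSeries q) = Polynomial.aeval Real.pi p := by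
  obtain ⟨P, hP, h⟩ := h
  let p : Polynomial ℚ := ∑ i ∈ Finset.HasAntidiagonal.antidiagonal n,
    Polynomial.monomial (i.2 + e) (coeff i.1 P * coeff i.2 S)
  have hcoeff : p.coeff (n + e) = constantCoeff P * coeff n S := by
    simp only [p, Polynomial.finsetSum_coeff, Polynomial.coeff_monomial]
    rw [Finset.sum_eq_single_of_mem (0, n) (by simp)]
    · simp
    · rintro ⟨a, b⟩ hab hne
      rw [if_neg]
      rw [Finset.HasAntidiagonal.mem_antidiagonal] at hab
      rintro hb
      have hb' : b = n := by simpa using hb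
      exact hne (by simp only [Prod.mk.injEq]; exact ⟨by simp at hab; omega, hb'⟩)
  have hne : p.coeff (n + e) ≠ 0 := by rw [hcoeff]; exact mul_ne_zero hP hS
  refine ⟨p, fun h0 => hne (by simp [h0]), ?_, ?_⟩
  · refine le_antisymm (Polynomial.natDegree_sum_le_of_forall_le _ _ fun i hi => ?_)
      (Polynomial.le_natDegree_of_ne_zero hne)
    exact (Polynomial.natDegree_monomial_le _).trans
      (Nat.add_le_add_right (Finset.HasAntidiagonal.antidiagonal.snd_le hi) e)
  · rw [h, mul_assoc, coeff_C_mul, coeff_mul, Finset.mul_sum, map_sum]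
    refine Finset.sum_congr rfl fun i _ => ?_
    rw [coeff_rescale, coeff_map, coeff_map, Polynomial.aeval_monomial, map_mul, pow_add]
    ring

end GammaReflection

/-- For `q` with `2q ∈ ℤ`, `q` not a nonpositive integer, the Taylor coefficients
`c_j = ∑_{i=0}^{2j} (−1)^i Γ^(i)(q) Γ^(2j−i)(q) / (i!(2j−i)!)` of `Γ(q+t)Γ(q−t)`
are linearly independent over the real algebraic numbers. -/
theorem gamma_product_coeffs_linearIndependent_over_algebraic
    (q : ℝ) (hq : ∃ k : ℤ, 2 * q = (k : ℝ))
    (hq' : ¬ ∃ k : ℤ, k ≤ 0 ∧ q = (k : ℝ))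
    (c : ℕ → ℝ)
    (hc : ∀ j : ℕ, c j = ∑ i ∈ Finset.range (2 * j + 1),
      (-1 : ℝ) ^ i * iteratedDeriv i Real.Gamma q * iteratedDeriv (2 * j - i) Real.Gamma q /
        ((Nat.factorial i : ℝ) * (Nat.factorial (2 * j - i) : ℝ)))
    (lam : ℕ → ℝ) (halg : ∀ j, IsAlgebraic ℚ (lam j))
    (hfin : (Function.support lam).Finite)
    (hsum : ∑ᶠ j : ℕ, lam j * c j = 0) :
    ∀ j, lam j = 0 := by
  obtain ⟨e, S, r, rfl, hS, hform⟩ := exists_gammaReflectionForm hq hq'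
  choose p hp0 hdeg hp using fun j => hform.exists_coeff_eq_aeval (hS j).ne'
  refine eq_zero_of_finsum_mul_aeval_transcendental_eq_zero Real.transcendental_pi hp0 ?_ halg hfin ?_
  · intro i j hij
    simp only [hdeg]
    omega
  · rw [← hsum]
    refine finsum_congr fun j => ?_
    rw [hc, ← hp, coeff_gammaReflectionSeries]
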